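/- arXiv:2501.17478 — 5 statements merged into one kernel-verified Lean document; each statement's English description precedes it below -/
import Mathlib

section
/- Let r be a positive integer, let f : ℝ^m → ℝ and u : ℝ → ℝ^m be r times continuously differentiable. Then the r-th derivative of the composition t ↦ f(u(t)) satisfies d^r f(u(t))/dt^r = Σ_{s ∈ P_r} (r! / (s_1! ⋯ s_r!)) · f^(|s|)(u(t))[D^s u(t)], where P_r = { s ∈ ℕ^r : Σ_{j=1}^r j·s_j = r }, |s| = Σ_{j=1}^r s_j, and f^(|s|)(u(t))[D^s u(t)] denotes the |s|-th derivative of f at u(t), viewed as a symmetric |s|-multilinear form, evaluated on the list of vectors containing, for each j = 1,…,r, exactly s_j copies of the vector (1/j!)·u^(j)(t). -/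
noncomputable def fdbA {E : Type*} [NormedAddCommGroup E] [NormedSpace ℝ E]
    (f : E → ℝ) (x : E) (l : List E) : ℝ :=
  iteratedFDeriv ℝ l.length f x (fun i => l.getD (i : ℕ) 0)

lemma fdbA_eq {E : Type*} [NormedAddCommGroup E] [NormedSpace ℝ E]
    (f : E → ℝ) (x : E) (l : List E) (n : ℕ) (h : l.length = n) :
    iteratedFDeriv ℝ n f x (fun i : Fin n => l.getD (i : ℕ) 0) = fdbA f x l := by
  subst h; rfl

lemma fdbA_cons' {E : Type*} [NormedAddCommGroup E] [NormedSpace ℝ E]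
    (f : E → ℝ) (x : E) (a : E) (l : List E) :
    fdbA f x (a :: l) = fderiv ℝ (iteratedFDeriv ℝ l.length f) x a (fun i => l.getD (i : ℕ) 0) := by
  rfl

lemma fdbA_cons {E : Type*} [NormedAddCommGroup E] [NormedSpace ℝ E]
    (f : E → ℝ) (x : E) (a : E) (l : List E) (hf : ContDiff ℝ (l.length + 1 : ℕ) f) :
    fdbA f x (a :: l) = fderiv ℝ (fun y => fdbA f y l) x a := by
  rw [fdbA_cons']
  have hd : DifferentiableAt ℝ (iteratedFDeriv ℝ l.length f) x :=
    (hf.differentiable_iteratedFDeriv (by exact_mod_cast Nat.lt_succ_self _)) x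
  have := (hd.hasFDerivAt.continuousMultilinear_apply_const (fun i => l.getD (i : ℕ) 0)).fderiv
  unfold fdbA
  rw [this]
  rfl

lemma fdbA_perm {E : Type*} [NormedAddCommGroup E] [NormedSpace ℝ E]
    (f : E → ℝ) {l l' : List E} (h : l.Perm l') (hf : ContDiff ℝ (l.length : ℕ) f) :
    (fun x => fdbA f x l) = (fun x => fdbA f x l') := by
  induction h with
  | nil => rfl
  | @cons a l l' h ih =>
    funext x
    have hf' : ContDiff ℝ (l.length : ℕ) f :=
      hf.of_le (by exact_mod_cast Nat.le_succ _)
    rw [fdbA_cons f x a l (by simpa using hf),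
      fdbA_cons f x a l' (by rw [← h.length_eq]; simpa using hf), ih hf']
  | swap a b l =>
    funext x
    have key : ∀ a b : E, fdbA f x (a :: b :: l) =
        fderiv ℝ (fderiv ℝ (iteratedFDeriv ℝ l.length f)) x a b (fun i => l.getD (i : ℕ) 0) := by
      intro a b
      rw [fdbA_cons f x a (b :: l) (by simpa using hf)]
      have hg : ContDiff ℝ 2 (iteratedFDeriv ℝ l.length f) :=
        hf.iteratedFDeriv_right (by push_cast [List.length_cons]; norm_num [add_comm, add_assoc, add_left_comm])
      have hd : DifferentiableAt ℝ (fderiv ℝ (iteratedFDeriv ℝ l.length f)) x :=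
        ((hg.fderiv_right (m := 1) (by norm_num)).differentiable (by norm_num)) x
      have h1 := hd.hasFDerivAt.clm_apply (hasFDerivAt_const b x)
      have h2 := (h1.continuousMultilinear_apply_const (fun i => l.getD (i : ℕ) 0)).fderiv
      simp only [fdbA_cons']
      rw [h2]
      simp
    rw [key, key]
    have hg : ContDiff ℝ 2 (iteratedFDeriv ℝ l.length f) :=
      hf.iteratedFDeriv_right (by push_cast [List.length_cons]; norm_num [add_comm, add_assoc, add_left_comm])
    have := (hg.contDiffAt (x := x)).isSymmSndFDerivAt (by simp)
    rw [this a b]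
  | trans h1 h2 ih1 ih2 =>
    rw [ih1 hf, ih2 (by rw [← h1.length_eq]; exact hf)]

lemma fdbA_smul {E : Type*} [NormedAddCommGroup E] [NormedSpace ℝ E]
    (f : E → ℝ) (x : E) (l : List ℕ) (c : ℕ → ℝ) (U : ℕ → E) :
    fdbA f x (l.map fun j => c j • U j) = (l.map c).prod * fdbA f x (l.map U) := by
  rw [← fdbA_eq f x _ l.length (by simp), ← fdbA_eq f x _ l.length (by simp)]
  have : (l.map c).prod = ∏ i : Fin l.length, c (l.get i) := by
    rw [← List.prod_ofFn]
    congr 1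
    apply List.ext_get <;> simp
  rw [this, ← smul_eq_mul, ← ContinuousMultilinearMap.map_smul_univ]
  congr 1
  funext i
  simp


def fdbM {n : ℕ} (c : OrderedFinpartition n) : Multiset ℕ :=
  (Finset.univ : Finset (Fin c.length)).val.map c.partSize

lemma fdbM_list {n : ℕ} (c : OrderedFinpartition n) : fdbM c = (List.ofFn c.partSize : Multiset ℕ) := by
  unfold fdbM
  exact Fin.univ_val_map c.partSize

lemma fdbM_pos {n : ℕ} (c : OrderedFinpartition n) : 0 ∉ fdbM c := by
  simp only [fdbM, Multiset.mem_map, not_exists, not_and]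
  intro k _ h
  have := c.partSize_pos k
  omega

lemma fdbM_le {n : ℕ} (c : OrderedFinpartition n) : ∀ a ∈ fdbM c, a ≤ n := by
  simp only [fdbM, Multiset.mem_map]
  rintro a ⟨k, _, rfl⟩
  exact c.partSize_le k

lemma fdbM_sum {n : ℕ} (c : OrderedFinpartition n) : (fdbM c).sum = n := by
  have := c.sum_sigma_eq_sum (fun _ => (1 : ℕ))
  simpa [fdbM, List.sum_ofFn] using this

lemma fdbM_left {n : ℕ} (c : OrderedFinpartition n) : fdbM c.extendLeft = 1 ::ₘ fdbM c := by
  rw [fdbM_list, fdbM_list]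
  show ((List.ofFn (Fin.cons 1 c.partSize : Fin (c.length + 1) → ℕ) : List ℕ) : Multiset ℕ) = _
  simp [List.ofFn_succ]

lemma fdbM_middle {n : ℕ} (c : OrderedFinpartition n) (k : Fin c.length) :
    c.partSize k ::ₘ fdbM (c.extendMiddle k) = (c.partSize k + 1) ::ₘ fdbM c := by
  have h1 : fdbM (c.extendMiddle k) = (Finset.univ : Finset (Fin c.length)).val.map
    (Function.update c.partSize k (c.partSize k + 1)) := rfl
  have h2 : (Finset.univ : Finset (Fin c.length)).val =
      k ::ₘ (Finset.univ.erase k).val := by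
    rw [Finset.erase_val, Multiset.cons_erase (Finset.mem_univ k)]
  rw [h1, fdbM, h2, Multiset.map_cons, Multiset.map_cons, Function.update_self,
    Multiset.cons_swap]
  congr 2
  apply Multiset.map_congr rfl
  intro j hj
  have : j ≠ k := Finset.ne_of_mem_erase (Finset.mem_def.2 hj)
  rw [Function.update_of_ne this]

noncomputable def fdbN (n : ℕ) (q : Multiset ℕ) : ℕ :=
  ∑ c : OrderedFinpartition n, if fdbM c = q then 1 else 0

def fdbW (q : Multiset ℕ) : ℕ :=
  (q.map Nat.factorial).prod * ∏ j ∈ q.toFinset, (q.count j).factorial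

lemma fdbW_pos (q : Multiset ℕ) : 0 < fdbW q := by
  unfold fdbW
  apply Nat.mul_pos
  · apply Nat.pos_of_ne_zero
    simp [Multiset.prod_eq_zero_iff, Nat.factorial_ne_zero]
  · exact Finset.prod_pos fun _ _ => Nat.factorial_pos _

lemma fdbW_cons (a : ℕ) (q : Multiset ℕ) :
    fdbW (a ::ₘ q) = a.factorial * (q.count a + 1) * fdbW q := by
  have h : ∀ p : Multiset ℕ, p ≤ a ::ₘ q → ∏ j ∈ p.toFinset, (p.count j).factorial =
      (p.count a).factorial * ∏ j ∈ (a ::ₘ q).toFinset.erase a, (p.count j).factorial := by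
    intro p hp
    rw [Finset.mul_prod_erase _ (fun j => (p.count j).factorial) (by simp)]
    apply Finset.prod_subset (Multiset.toFinset_subset.2 (Multiset.subset_of_le hp))
    intro x _ hx
    rw [Multiset.count_eq_zero_of_notMem (by simpa using hx), Nat.factorial_zero]
  unfold fdbW
  rw [h _ le_rfl, h q (Multiset.le_cons_self _ _), Multiset.map_cons, Multiset.prod_cons,
    Multiset.count_cons_self, Nat.factorial_succ]
  have : ∏ j ∈ (a ::ₘ q).toFinset.erase a, ((a ::ₘ q).count j).factorial =
      ∏ j ∈ (a ::ₘ q).toFinset.erase a, (q.count j).factorial := by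
    apply Finset.prod_congr rfl
    intro x hx
    rw [Multiset.count_cons_of_ne (Finset.ne_of_mem_erase hx)]
  rw [this]
  ring

lemma fdbN_succ (n : ℕ) (q : Multiset ℕ) :
    fdbN (n + 1) q = ∑ c : OrderedFinpartition n, ((if 1 ::ₘ fdbM c = q then 1 else 0) +
      ∑ a ∈ Finset.range n, (fdbM c).count (a + 1) *
        (if (a + 2) ::ₘ fdbM c = (a + 1) ::ₘ q then 1 else 0)) := by
  unfold fdbN
  rw [← (OrderedFinpartition.extendEquiv n).sum_comp, Fintype.sum_sigma]
  refine Finset.sum_congr rfl fun c _ => ?_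
  rw [Fintype.sum_option]
  simp only [OrderedFinpartition.extendEquiv_apply, OrderedFinpartition.extend_none,
    OrderedFinpartition.extend_some, fdbM_left]
  congr 1
  have h1 : ∀ k : Fin c.length, (if fdbM (c.extendMiddle k) = q then 1 else 0) =
      (fun a => if (a + 1) ::ₘ fdbM c = a ::ₘ q then 1 else 0) (c.partSize k) := by
    intro k
    simp only [← fdbM_middle, Multiset.cons_inj_right]
  rw [Finset.sum_congr rfl fun k _ => h1 k]
  have h2 : ∀ g : ℕ → ℕ, ∑ k : Fin c.length, g (c.partSize k) = ((fdbM c).map g).sum := by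
    intro g
    simp [fdbM, List.sum_ofFn]
  rw [h2 (fun a => if (a + 1) ::ₘ fdbM c = a ::ₘ q then 1 else 0), Finset.sum_multiset_map_count, Finset.sum_subset (s₂ := Finset.range (n + 1)),
    Finset.sum_range_succ', Multiset.count_eq_zero_of_notMem (fdbM_pos c)]
  · simp
  · intro a ha
    have := fdbM_le c a (by simpa using ha)
    simp; omega
  · intro x _ hx
    rw [Multiset.count_eq_zero_of_notMem (by simpa using hx), zero_smul]

lemma fdbN_mul (n : ℕ) : ∀ q : Multiset ℕ, 0 ∉ q → q.sum = n →
    fdbN n q * fdbW q = n.factorial := by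
  induction n with
  | zero =>
    intro q h0 hs
    have : q = 0 := by
      apply Multiset.eq_zero_of_forall_notMem
      intro a ha
      have := Multiset.le_sum_of_mem ha
      have : a = 0 := by omega
      exact h0 (this ▸ ha)
    subst this
    have : ∀ c : OrderedFinpartition 0, fdbM c = 0 := by
      intro c
      apply Multiset.eq_zero_of_forall_notMem
      intro a ha
      have := fdbM_le c a ha
      have : a = 0 := by omega
      exact fdbM_pos c (this ▸ ha)
    simp [fdbN, fdbW, this]
  | succ n ih =>
    intro q h0 hs
    rw [fdbN_succ, Finset.sum_add_distrib, Finset.sum_comm, add_mul]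
    have hA : (∑ c : OrderedFinpartition n, if 1 ::ₘ fdbM c = q then 1 else 0) * fdbW q
        = n.factorial * (q.count 1 * 1) := by
      by_cases h1 : 1 ∈ q
      · obtain ⟨p, rfl⟩ := Multiset.exists_cons_of_mem h1
        simp only [Multiset.cons_inj_right]
        have := ih p (fun h => h0 (Multiset.mem_cons_of_mem h)) (by simp at hs; omega)
        unfold fdbN at this
        rw [fdbW_cons, ← this, Multiset.count_cons_self, Nat.factorial_one]
        ring
      · rw [Multiset.count_eq_zero_of_notMem h1, Finset.sum_eq_zero]
        · simp
        · intro c _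
          rw [if_neg]
          rintro rfl
          simp at h1
    have hB : ∀ a, (∑ c : OrderedFinpartition n, (fdbM c).count (a + 1) *
        (if (a + 2) ::ₘ fdbM c = (a + 1) ::ₘ q then 1 else 0)) * fdbW q =
        n.factorial * (q.count (a + 2) * (a + 2)) := by
      intro a
      by_cases h1 : (a + 2) ∈ q
      · obtain ⟨p, rfl⟩ := Multiset.exists_cons_of_mem h1
        have e : ∀ c : OrderedFinpartition n, (fdbM c).count (a + 1) *
            (if (a + 2) ::ₘ fdbM c = (a + 1) ::ₘ (a + 2) ::ₘ p then 1 else 0) =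
            (p.count (a + 1) + 1) * (if fdbM c = (a + 1) ::ₘ p then 1 else 0) := by
          intro c
          simp only [Multiset.cons_swap (a + 1) (a + 2), Multiset.cons_inj_right]
          split_ifs with h
          · rw [h, Multiset.count_cons_self]
          · simp
        rw [Finset.sum_congr rfl fun c _ => e c, ← Finset.mul_sum]
        have := ih ((a + 1) ::ₘ p) (by
          intro h
          rcases Multiset.mem_cons.1 h with h | h
          · omega
          · exact h0 (Multiset.mem_cons_of_mem h)) (by simp at hs ⊢; omega)
        unfold fdbN at this
        rw [fdbW_cons] at this ⊢
        rw [← this, Multiset.count_cons_self, Nat.factorial_succ (a + 1)]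
        ring
      · rw [Multiset.count_eq_zero_of_notMem h1, Finset.sum_eq_zero]
        · simp
        · intro c _
          rw [if_neg, mul_zero]
          intro h
          have : a + 2 ∈ (a + 1) ::ₘ q := h ▸ Multiset.mem_cons_self _ _
          rcases Multiset.mem_cons.1 this with h | h
          · omega
          · exact h1 h
    rw [hA, Finset.sum_mul, Finset.sum_congr rfl fun a _ => hB a, ← Finset.mul_sum, ← mul_add, Nat.factorial_succ,
      mul_comm (n + 1)]
    congr 1
    have hq : q.sum = ∑ a ∈ Finset.range (n + 2), q.count a * a := by
      rw [Finset.sum_multiset_count]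
      simp only [smul_eq_mul]
      apply Finset.sum_subset
      · intro a ha
        have := Multiset.le_sum_of_mem (Multiset.mem_toFinset.1 ha)
        simp; omega
      · intro x _ hx
        rw [Multiset.count_eq_zero_of_notMem (by simpa using hx), zero_mul]
    rw [← hs, hq, Finset.sum_range_succ', Finset.sum_range_succ']
    simp only [mul_zero, add_zero, zero_add]
    exact Nat.add_comm _ _

def fdbL {r : ℕ} (s : Fin r → ℕ) : List ℕ :=
  (List.ofFn fun j : Fin r => List.replicate (s j) (j.1 + 1)).flatten

lemma fdbL_map {α : Type*} {r : ℕ} (s : Fin r → ℕ) (g : ℕ → α) :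
    (fdbL s).map g = (List.ofFn fun j : Fin r => List.replicate (s j) (g (j.1 + 1))).flatten := by
  simp [fdbL, List.map_flatten, List.map_ofFn, Function.comp_def]

lemma fdbL_prod {r : ℕ} (s : Fin r → ℕ) {M : Type*} [CommMonoid M] (g : ℕ → M) :
    ((fdbL s).map g).prod = ∏ j : Fin r, g (j.1 + 1) ^ s j := by
  rw [fdbL_map, List.prod_flatten, List.map_ofFn, List.prod_ofFn]
  simp

lemma fdbL_sum {r : ℕ} (s : Fin r → ℕ) : (fdbL s).sum = ∑ j : Fin r, (j.1 + 1) * s j := by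
  rw [fdbL, List.sum_flatten, List.map_ofFn, List.sum_ofFn]
  simp [mul_comm]

lemma fdbL_length {r : ℕ} (s : Fin r → ℕ) : (fdbL s).length = ∑ j : Fin r, s j := by
  rw [fdbL, List.length_flatten, List.map_ofFn, List.sum_ofFn]
  simp

lemma fdbL_count {r : ℕ} (s : Fin r → ℕ) (j : Fin r) : (fdbL s).count (j.1 + 1) = s j := by
  rw [fdbL, List.count_flatten, List.map_ofFn, List.sum_ofFn]
  simp only [Function.comp_apply, List.count_replicate]
  rw [Finset.sum_eq_single j]
  · simp
  · intro b _ hb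
    have : b.1 ≠ j.1 := fun h => hb (Fin.ext h)
    simp [this]
  · simp

lemma fdbL_mem {r : ℕ} (s : Fin r → ℕ) (a : ℕ) (h : a ∈ fdbL s) : ∃ j : Fin r, a = j.1 + 1 := by
  simp only [fdbL, List.mem_flatten, List.mem_ofFn] at h
  obtain ⟨l, ⟨j, rfl⟩, h⟩ := h
  exact ⟨j, List.eq_of_mem_replicate h⟩

lemma fdbL_W {r : ℕ} (s : Fin r → ℕ) : fdbW (fdbL s : Multiset ℕ) =
    (∏ j : Fin r, (j.1 + 1).factorial ^ s j) * ∏ j : Fin r, (s j).factorial := by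
  unfold fdbW
  rw [Multiset.map_coe, Multiset.prod_coe, fdbL_prod]
  congr 1
  rw [Finset.prod_subset (s₂ := Finset.univ.image fun j : Fin r => j.1 + 1)]
  · rw [Finset.prod_image]
    · simp only [Multiset.coe_count, fdbL_count]
    · intro a _ b _ h
      simp only at h
      exact Fin.ext (by omega)
  · intro a ha
    obtain ⟨j, rfl⟩ := fdbL_mem s a (by simpa using ha)
    simp
  · intro x _ hx
    rw [Multiset.count_eq_zero_of_notMem (by simpa using hx), Nat.factorial_zero]

def fdbS {r : ℕ} (c : OrderedFinpartition r) : Fin r → ℕ := fun j => (fdbM c).count (j.1 + 1)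

lemma fdbM_eq_iff {r : ℕ} (c : OrderedFinpartition r) (s : Fin r → ℕ) :
    fdbM c = (fdbL s : Multiset ℕ) ↔ fdbS c = s := by
  constructor
  · intro h
    funext j
    rw [fdbS, h, Multiset.coe_count, fdbL_count]
  · rintro rfl
    ext a
    by_cases h : ∃ j : Fin r, a = j.1 + 1
    · obtain ⟨j, rfl⟩ := h
      rw [Multiset.coe_count, fdbL_count, fdbS]
    · rw [Multiset.count_eq_zero_of_notMem, Multiset.count_eq_zero_of_notMem]
      · intro h'
        exact h (fdbL_mem _ _ (by simpa using h'))
      · intro h'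
        have h1 := fdbM_le c a h'
        have h2 : a ≠ 0 := fun h2 => fdbM_pos c (h2 ▸ h')
        exact h ⟨⟨a - 1, by omega⟩, by simp; omega⟩

/-- Faà di Bruno's formula: for `f : ℝ^m → ℝ` and `u : ℝ → ℝ^m` both `r` times
continuously differentiable, the `r`-th derivative of `t ↦ f (u t)` is a sum over
`P_r = {s ∈ ℕ^r : Σ j·s_j = r}` of multinomial coefficients times the `|s|`-th
derivative of `f` at `u t` evaluated on `s_j` copies of `(1/j!) • u^{(j)}(t)` for each `j`. -/
theorem faa_di_bruno (m r : ℕ) (hr : 1 ≤ r)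
    (f : (Fin m → ℝ) → ℝ) (u : ℝ → Fin m → ℝ)
    (hf : ContDiff ℝ r f) (hu : ContDiff ℝ r u) (t : ℝ) :
    iteratedDeriv r (fun x => f (u x)) t =
      ∑ᶠ s ∈ {s : Fin r → ℕ | ∑ j : Fin r, (j.1 + 1) * s j = r},
        ((r.factorial : ℝ) / ∏ j : Fin r, ((s j).factorial : ℝ)) *
          iteratedFDeriv ℝ (∑ j : Fin r, s j) f (u t)
            (fun i : Fin (∑ j : Fin r, s j) =>
              ((List.ofFn fun j : Fin r =>
                  List.replicate (s j)
                    ((((j.1 + 1).factorial : ℝ))⁻¹ • iteratedDeriv (j.1 + 1) u t)).flatten).getD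
                (i : ℕ) 0) := by
  set P : Set (Fin r → ℕ) := {s : Fin r → ℕ | ∑ j : Fin r, (j.1 + 1) * s j = r} with hP
  have hfin : P.Finite := by
    apply (Set.Finite.pi' (fun _ : Fin r => Set.finite_Iic r)).subset
    intro s hs j
    have hs' : ∑ j : Fin r, (j.1 + 1) * s j = r := hs
    have h1 : (j.1 + 1) * s j ≤ ∑ j : Fin r, (j.1 + 1) * s j :=
      Finset.single_le_sum (f := fun j : Fin r => (j.1 + 1) * s j)
        (fun _ _ => Nat.zero_le _) (Finset.mem_univ j)
    show s j ≤ r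
    nlinarith
  rw [finsum_mem_eq_finite_toFinset_sum _ hfin]
  have hL := iteratedDeriv_vcomp_eq_sum_orderedFinpartition (x := t) (i := r)
    hf.contDiffAt hu.contDiffAt le_rfl
  have hcomp : (fun x => f (u x)) = f ∘ u := rfl
  rw [hcomp, hL]
  set U : ℕ → Fin m → ℝ := fun j => iteratedDeriv j u t with hU
  rw [← Finset.sum_fiberwise_of_maps_to (g := fdbS) (t := hfin.toFinset)]
  · refine Finset.sum_congr rfl fun s hs => ?_
    have hs' : ∑ j : Fin r, (j.1 + 1) * s j = r := by simpa [hP] using hs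
    have hterm : ∀ c ∈ Finset.univ.filter (fun c : OrderedFinpartition r => fdbS c = s),
        (iteratedFDeriv ℝ c.length f (u t) fun j => iteratedDeriv (c.partSize j) u t) =
          fdbA f (u t) ((fdbL s).map U) := by
      intro c hc
      have hc' := (fdbM_eq_iff c s).2 (Finset.mem_filter.1 hc).2
      rw [fdbM_list, Multiset.coe_eq_coe] at hc'
      have h1 := congrFun (fdbA_perm f (hc'.map U) (hf.of_le (by
        simpa using c.length_le))) (u t)
      rw [← h1, ← fdbA_eq f (u t) _ c.length (by simp)]
      congr 1
      funext i
      simp [hU]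
    rw [Finset.sum_congr rfl hterm, Finset.sum_const, nsmul_eq_mul]
    have hlist : (List.ofFn fun j : Fin r => List.replicate (s j)
        ((((j.1 + 1).factorial : ℝ))⁻¹ • iteratedDeriv (j.1 + 1) u t)).flatten =
        (fdbL s).map (fun j => ((j.factorial : ℝ))⁻¹ • U j) := by
      rw [fdbL_map]
    rw [hlist, fdbA_eq _ _ _ _ (by rw [List.length_map, fdbL_length]), fdbA_smul, ← mul_assoc,
      fdbL_prod]
    congr 1
    have hN : (Finset.univ.filter (fun c : OrderedFinpartition r => fdbS c = s)).card =
        fdbN r (fdbL s : Multiset ℕ) := by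
      rw [fdbN, Finset.card_filter]
      simp only [fdbM_eq_iff]
    have hW := fdbN_mul r (fdbL s : Multiset ℕ) (by
      intro h
      obtain ⟨j, hj⟩ := fdbL_mem s 0 (by simpa using h)
      omega) (by rw [Multiset.sum_coe, fdbL_sum, hs'])
    rw [fdbL_W] at hW
    rw [hN, ← hW]
    push_cast
    have e1 : (∏ j : Fin r, ((s j).factorial : ℝ)) ≠ 0 :=
      Finset.prod_ne_zero_iff.2 fun j _ => by positivity
    have e2 : (∏ j : Fin r, ((j.1 + 1).factorial : ℝ) ^ s j) ≠ 0 :=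
      Finset.prod_ne_zero_iff.2 fun j _ => by positivity
    simp only [inv_pow, Finset.prod_inv_distrib]
    field_simp
  · intro c _
    have h := (fdbM_eq_iff c (fdbS c)).2 rfl
    have h2 := fdbM_sum c
    rw [h, Multiset.sum_coe, fdbL_sum] at h2
    simpa [hP] using h2
end

section
/- Let R ≥ 1 be an integer, m ≥ 1, and let u : ℝ → ℝ^m be (R+1) times continuously differentiable on a neighborhood of a point t. Suppose h₀ > 0, C > 0 and v^(l) : (0, h₀) → ℝ^m for l = 0,…,R satisfy v^(0)(h) = u(t), v^(1)(h) = u'(t), and ‖v^(l)(h) − u^(l)(t)‖ ≤ C·h^{R+1−l} for all 2 ≤ l ≤ R and all 0 < h < h₀. Then there exist C' > 0 and h₁ ∈ (0, h₀] such that ‖u(t+h) − Σ_{l=0}^R (h^l/l!)·v^(l)(h)‖ ≤ C'·h^{R+1} for all 0 < h < h₁. -/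
/-- If `v 0 h = u t`, `v 1 h = u' t` exactly and `v l h` approximates `u^{(l)} t` with
error `O(h^{R+1-l})` for `2 ≤ l ≤ R`, then the one-step Taylor-type update
`Σ_{l=0}^R (h^l/l!) • v l h` has local truncation error `O(h^{R+1})`. -/
theorem approximate_taylor_step_accuracy (R m : ℕ) (hR : 1 ≤ R) (hm : 1 ≤ m)
    (u : ℝ → Fin m → ℝ) (t : ℝ) (hu : ContDiffAt ℝ (R + 1) u t)
    (h₀ C : ℝ) (hh₀ : 0 < h₀) (hC : 0 < C)
    (v : ℕ → ℝ → Fin m → ℝ)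
    (hv0 : ∀ h ∈ Set.Ioo (0 : ℝ) h₀, v 0 h = u t)
    (hv1 : ∀ h ∈ Set.Ioo (0 : ℝ) h₀, v 1 h = deriv u t)
    (hv : ∀ l, 2 ≤ l → l ≤ R → ∀ h ∈ Set.Ioo (0 : ℝ) h₀,
      ‖v l h - iteratedDeriv l u t‖ ≤ C * h ^ (R + 1 - l)) :
    ∃ C' > 0, ∃ h₁, 0 < h₁ ∧ h₁ ≤ h₀ ∧ ∀ h : ℝ, 0 < h → h < h₁ →
      ‖u (t + h) - ∑ l ∈ Finset.range (R + 1), (h ^ l / l.factorial) • v l h‖ ≤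
        C' * h ^ (R + 1) := by
  have hev := hu.eventually (by exact_mod_cast (ENat.coe_ne_top (R + 1)))
  obtain ⟨ε, hε, hball⟩ := Metric.eventually_nhds_iff.1 hev
  have hδ : t < t + ε / 2 := by linarith
  have hcd : ContDiffOn ℝ (R + 1) u (Set.Icc t (t + ε / 2)) := by
    intro x hx
    refine (hball ?_).contDiffWithinAt
    rw [Real.dist_eq, abs_of_nonneg (by linarith [hx.1])]
    linarith [hx.2]
  obtain ⟨K, hK⟩ := exists_taylor_mean_remainder_bound hδ.le hcd
  refine ⟨|K| + (R + 1) * C, by positivity, min h₀ (ε / 2), by positivity, min_le_left _ _, ?_⟩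
  intro h hpos hlt
  have hlt0 : h < h₀ := hlt.trans_le (min_le_left _ _)
  have hlt1 : h < ε / 2 := hlt.trans_le (min_le_right _ _)
  have hT := hK (t + h) ⟨by linarith, by linarith⟩
  rw [taylor_within_apply, add_sub_cancel_left] at hT
  have hsum : ∑ k ∈ Finset.range (R + 1), ((k.factorial : ℝ)⁻¹ * h ^ k) •
        iteratedDerivWithin k u (Set.Icc t (t + ε / 2)) t
      = ∑ k ∈ Finset.range (R + 1), (h ^ k / k.factorial) • iteratedDeriv k u t := by
    refine Finset.sum_congr rfl fun k hk => ?_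
    have hk' : k < R + 1 := Finset.mem_range.1 hk
    rw [iteratedDerivWithin_eq_iteratedDeriv (uniqueDiffOn_Icc hδ)
      (hu.of_le (by exact_mod_cast hk'.le)) ⟨le_rfl, hδ.le⟩, div_eq_inv_mul]
  rw [hsum] at hT
  have hterm : ∀ l ∈ Finset.range (R + 1),
      ‖(h ^ l / l.factorial) • iteratedDeriv l u t - (h ^ l / l.factorial) • v l h‖
        ≤ C * h ^ (R + 1) := by
    intro l hl
    have hl' : l ≤ R := Nat.lt_succ_iff.1 (Finset.mem_range.1 hl)
    have hnn : 0 ≤ C * h ^ (R + 1) := by positivity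
    rcases Nat.lt_or_ge l 2 with h2 | h2
    · interval_cases l
      · simpa [hv0 h ⟨hpos, hlt0⟩] using hnn
      · simpa [hv1 h ⟨hpos, hlt0⟩] using hnn
    · have hb := hv l h2 hl' h ⟨hpos, hlt0⟩
      have hf : (1 : ℝ) ≤ l.factorial := by exact_mod_cast Nat.succ_le_of_lt l.factorial_pos
      have hc : h ^ l / l.factorial ≤ h ^ l := div_le_self (by positivity) hf
      rw [← smul_sub, norm_smul, Real.norm_of_nonneg (by positivity), norm_sub_rev]
      calc h ^ l / l.factorial * ‖v l h - iteratedDeriv l u t‖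
          ≤ h ^ l * (C * h ^ (R + 1 - l)) :=
            mul_le_mul hc hb (norm_nonneg _) (by positivity)
        _ = C * (h ^ l * h ^ (R + 1 - l)) := by ring
        _ = C * h ^ (R + 1) := by rw [← pow_add, Nat.add_sub_of_le (by omega)]
  have hS := norm_sum_le_of_le _ hterm
  rw [Finset.sum_sub_distrib, Finset.sum_const, Finset.card_range, nsmul_eq_mul] at hS
  push_cast at hS
  have hKK : K * h ^ (R + 1) ≤ |K| * h ^ (R + 1) := by
    gcongr
    exact le_abs_self K
  refine (norm_sub_le_norm_sub_add_norm_sub _ _ _).trans ((add_le_add hT hS).trans ?_)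
  linarith
end

section
/- Let k ≥ 1 and R ≥ k be integers, m ≥ 1, let f : ℝ^m → ℝ^m be k times continuously differentiable, and let u : ℝ → ℝ^m be k times continuously differentiable on a neighborhood of a point t. Suppose h₀ > 0, C > 0 and v^(l) : (0, h₀) → ℝ^m for l = 0,…,k satisfy v^(0)(h) = u(t) and ‖v^(l)(h) − u^(l)(t)‖ ≤ C·h^{R−l+1} for all 1 ≤ l ≤ k and all 0 < h < h₀. For each h define the polynomial curve w_h : ℝ → ℝ^m by w_h(ρ) = Σ_{l=0}^k (v^(l)(h)/l!)·ρ^l. Then there exist C' > 0 and h₁ ∈ (0, h₀] such that ‖ (d^k/dρ^k)(f ∘ w_h)(0) − (d^k/ds^k)(f ∘ u)(t) ‖ ≤ C'·h^{R−k+1} for all 0 < h < h₁. -/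
/-- The `l`-th derivative at `0` of a Taylor-type polynomial is its `l`-th coefficient. -/
theorem taylor_poly_iteratedDeriv_zero {m : ℕ} (k l : ℕ) (hl : l ≤ k) (a : ℕ → Fin m → ℝ) :
    iteratedDeriv l
      (fun ρ : ℝ => ∑ i ∈ Finset.range (k + 1), (ρ ^ i / i.factorial) • a i) 0 = a l := by
  rw [iteratedDeriv_fun_sum (fun i _ => by fun_prop)]
  rw [Finset.sum_eq_single l]
  · rw [iteratedDeriv_smul_const (by fun_prop)]
    simp only [div_eq_inv_mul]
    rw [iteratedDeriv_const_mul_field, iteratedDeriv_fun_pow_zero]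
    have : (l.factorial : ℝ) ≠ 0 := by positivity
    simp [this]
  · intro i _ hi
    rw [iteratedDeriv_smul_const (by fun_prop)]
    simp only [div_eq_inv_mul]
    rw [iteratedDeriv_const_mul_field, iteratedDeriv_fun_pow_zero]
    simp [Ne.symm hi]
  · intro h
    exact absurd (Finset.mem_range.2 (by omega)) h

/-- Key estimate of the accuracy proof for approximate Taylor methods: if the
coefficients `v l h` of the degree-`k` approximate Taylor polynomial `w h` of `u` at `t`
approximate `u^{(l)} t` with errors `O(h^{R-l+1})` and the constant term is exact, then
the `k`-th derivative of `f ∘ w h` at `0` approximates the `k`-th derivative of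
`f ∘ u` at `t` with error `O(h^{R-k+1})`. -/
theorem approximate_taylor_faa_di_bruno_estimate (k R m : ℕ) (hk : 1 ≤ k) (hkR : k ≤ R)
    (hm : 1 ≤ m) (f : (Fin m → ℝ) → Fin m → ℝ) (hf : ContDiff ℝ k f)
    (u : ℝ → Fin m → ℝ) (t : ℝ) (hu : ContDiffAt ℝ k u t)
    (h₀ C : ℝ) (hh₀ : 0 < h₀) (hC : 0 < C)
    (v : ℕ → ℝ → Fin m → ℝ)
    (hv0 : ∀ h ∈ Set.Ioo (0 : ℝ) h₀, v 0 h = u t)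
    (hv : ∀ l, 1 ≤ l → l ≤ k → ∀ h ∈ Set.Ioo (0 : ℝ) h₀,
      ‖v l h - iteratedDeriv l u t‖ ≤ C * h ^ (R - l + 1)) :
    ∃ C' > 0, ∃ h₁, 0 < h₁ ∧ h₁ ≤ h₀ ∧ ∀ h : ℝ, 0 < h → h < h₁ →
      ‖iteratedDeriv k
          (fun ρ : ℝ => f (∑ l ∈ Finset.range (k + 1), (ρ ^ l / l.factorial) • v l h)) 0 -
        iteratedDeriv k (fun s : ℝ => f (u s)) t‖ ≤ C' * h ^ (R - k + 1) := by
  set B : ℝ := (∑ l ∈ Finset.range (k + 1), ‖iteratedDeriv l u t‖) + C with hB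
  set K : OrderedFinpartition k → ℝ := fun c =>
    ‖iteratedFDeriv ℝ c.length f (u t)‖ * c.length * B ^ (c.length - 1) * C with hK
  have hB0 : 0 ≤ B := by positivity
  have hK0 : ∀ c, 0 ≤ K c := fun c => by simp only [hK]; positivity
  refine ⟨1 + ∑ c, K c, by
    have := Finset.sum_nonneg (fun c (_ : c ∈ Finset.univ) => hK0 c)
    linarith, min h₀ 1, by positivity, min_le_left _ _, ?_⟩
  intro h hpos hlt
  have hh0 : h < h₀ := hlt.trans_le (min_le_left _ _)
  have hh1 : h ≤ 1 := (hlt.trans_le (min_le_right _ _)).le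
  have hmem : h ∈ Set.Ioo (0 : ℝ) h₀ := ⟨hpos, hh0⟩
  set w : ℝ → Fin m → ℝ :=
    fun ρ => ∑ l ∈ Finset.range (k + 1), (ρ ^ l / l.factorial) • v l h with hw
  have hw0 : w 0 = u t := by
    have := taylor_poly_iteratedDeriv_zero k 0 (Nat.zero_le _) (fun l => v l h)
    rw [iteratedDeriv_zero] at this
    rw [← hv0 h hmem]
    exact this
  have hwd : ContDiff ℝ k w := by
    simp only [hw]
    fun_prop
  have e1 : iteratedDeriv k (fun ρ => f (w ρ)) 0 = _ :=
    iteratedDeriv_vcomp_eq_sum_orderedFinpartition (g := f) (f := w) (x := (0 : ℝ))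
      hf.contDiffAt hwd.contDiffAt le_rfl
  have e2 : iteratedDeriv k (fun s => f (u s)) t = _ :=
    iteratedDeriv_vcomp_eq_sum_orderedFinpartition (g := f) (f := u) (x := t)
      hf.contDiffAt hu le_rfl
  change ‖iteratedDeriv k (fun ρ => f (w ρ)) 0 - _‖ ≤ _
  rw [e1, e2, hw0, ← Finset.sum_sub_distrib]
  have hp : 0 ≤ h ^ (R - k + 1) := by positivity
  have hp1 : h ^ (R - k + 1) ≤ 1 := pow_le_one₀ hpos.le hh1
  have key : ∀ l, 1 ≤ l → l ≤ k →
      ‖v l h - iteratedDeriv l u t‖ ≤ C * h ^ (R - k + 1) := fun l h1 h2 =>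
    (hv l h1 h2 h hmem).trans
      (mul_le_mul_of_nonneg_left (pow_le_pow_of_le_one hpos.le hh1 (by omega)) hC.le)
  have hub : ∀ l, l ≤ k → ‖iteratedDeriv l u t‖ + C ≤ B := fun l hl => by
    have := Finset.single_le_sum (f := fun l => ‖iteratedDeriv l u t‖)
      (fun i _ => norm_nonneg _) (Finset.mem_range.2 (Nat.lt_succ_of_le hl))
    linarith
  have hvb : ∀ l, 1 ≤ l → l ≤ k → ‖v l h‖ ≤ B := fun l h1 h2 => by
    have a1 := key l h1 h2
    have a2 := hub l h2
    have a3 := norm_sub_norm_le (v l h) (iteratedDeriv l u t)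
    nlinarith
  have main : ∀ c : OrderedFinpartition k,
      ‖(iteratedFDeriv ℝ c.length f (u t) fun j => iteratedDeriv (c.partSize j) w 0) -
        iteratedFDeriv ℝ c.length f (u t) fun j => iteratedDeriv (c.partSize j) u t‖ ≤
      K c * h ^ (R - k + 1) := by
    intro c
    have hp1 : ∀ j, 1 ≤ c.partSize j := c.partSize_pos
    have hp2 : ∀ j, c.partSize j ≤ k := c.partSize_le
    have hwv : (fun j => iteratedDeriv (c.partSize j) w 0) = fun j => v (c.partSize j) h :=
      funext fun j => taylor_poly_iteratedDeriv_zero k _ (hp2 j) (fun l => v l h)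
    rw [hwv]
    refine (ContinuousMultilinearMap.norm_image_sub_le _ _ _).trans ?_
    have n1 : ‖fun j => v (c.partSize j) h‖ ≤ B :=
      (pi_norm_le_iff_of_nonneg hB0).2 fun j => hvb _ (hp1 j) (hp2 j)
    have n2 : ‖fun j => iteratedDeriv (c.partSize j) u t‖ ≤ B :=
      (pi_norm_le_iff_of_nonneg hB0).2 fun j => by linarith [hub _ (hp2 j)]
    have n3 : ‖(fun j => v (c.partSize j) h) - fun j => iteratedDeriv (c.partSize j) u t‖ ≤
        C * h ^ (R - k + 1) :=
      (pi_norm_le_iff_of_nonneg (by positivity)).2 fun j => key _ (hp1 j) (hp2 j)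
    have n4 := max_le n1 n2
    simp only [hK, Fintype.card_fin]
    rw [mul_assoc _ C]
    gcongr
  refine (norm_sum_le _ _).trans ((Finset.sum_le_sum fun c _ => main c).trans ?_)
  rw [← Finset.sum_mul]
  nlinarith
end

section
/- Let m ≥ 1, let f : ℝ^m → ℝ^m be three times continuously differentiable, and let u : ℝ → ℝ^m solve u' = f(u) on a neighborhood of a point t. Then there exist constants C > 0 and h₀ > 0 such that for all 0 < h < h₀, ‖ ( f(u(t) + h·f(u(t))) − f(u(t) − h·f(u(t))) ) / (2h) − u''(t) ‖ ≤ C·h². -/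
/-- The centered finite difference of `f` along the degree-1 Taylor polynomial of `u`
approximates `u'' t` to second order, for `u' = f u` with `f` of class `C³`. -/
theorem second_derivative_centered_difference (m : ℕ) (hm : 1 ≤ m)
    (f : (Fin m → ℝ) → Fin m → ℝ) (hf : ContDiff ℝ 3 f)
    (u : ℝ → Fin m → ℝ) (t : ℝ)
    (hu : ∀ᶠ x in nhds t, HasDerivAt u (f (u x)) x) :
    ∃ C > 0, ∃ h₀ > 0, ∀ h : ℝ, 0 < h → h < h₀ →
      ‖(2 * h)⁻¹ • (f (u t + h • f (u t)) - f (u t - h • f (u t))) -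
        iteratedDeriv 2 u t‖ ≤ C * h ^ 2 := by
  have hfd : ∀ x, HasFDerivAt f (fderiv ℝ f x) x := fun x =>
    (hf.differentiable (by norm_num) x).hasFDerivAt
  have h2 : iteratedDeriv 2 u t = fderiv ℝ f (u t) (f (u t)) := by
    rw [iteratedDeriv_succ, iteratedDeriv_one]
    have he : deriv u =ᶠ[nhds t] fun x => f (u x) := by
      filter_upwards [hu] with x hx using hx.deriv
    rw [he.deriv_eq]
    exact ((hfd (u t)).comp_hasDerivAt t hu.self_of_nhds).deriv
  rw [h2]
  generalize u t = a
  set v := f a with hv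
  set G : ℝ → Fin m → ℝ := fun h => f (a + h • v) - f (a - h • v) with hG
  have hGc : ContDiff ℝ 3 G := by
    rw [hG]
    fun_prop
  have hG0 : G 0 = 0 := by simp [hG]
  have hG1 : deriv G 0 = (2 : ℝ) • fderiv ℝ f a v := by
    have h1 : HasDerivAt (fun h : ℝ => a + h • v) v 0 := by
      simpa using ((hasDerivAt_id (0 : ℝ)).smul_const v).const_add a
    have h3 : HasDerivAt (fun h : ℝ => a - h • v) (-v) 0 := by
      simpa using ((hasDerivAt_id (0 : ℝ)).smul_const v).const_sub a
    have e1 : HasFDerivAt f (fderiv ℝ f a) (a + (0 : ℝ) • v) := by simpa using hfd a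
    have e2 : HasFDerivAt f (fderiv ℝ f a) (a - (0 : ℝ) • v) := by simpa using hfd a
    have h4 := ((e1.comp_hasDerivAt (0 : ℝ) h1).sub (e2.comp_hasDerivAt (0 : ℝ) h3)).deriv
    refine Eq.trans h4 ?_
    rw [map_neg, sub_neg_eq_add, two_smul]
  have hG2 : iteratedDeriv 2 G 0 = 0 := by
    have h5 := iteratedDeriv_comp_neg 2 G 0
    have h6 : (fun x => G (-x)) = -G := by
      funext x
      simp [hG, sub_eq_add_neg]
    rw [h6, iteratedDeriv_neg] at h5
    simp only [neg_zero, even_two, Even.neg_pow, one_pow, one_smul] at h5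
    exact self_eq_neg.mp h5.symm
  obtain ⟨C, hC⟩ := exists_taylor_mean_remainder_bound (f := G) (n := 2) (zero_le_one' ℝ)
    (by exact_mod_cast hGc.contDiffOn)
  have hw : ∀ k : ℕ, k ≤ 3 → iteratedDerivWithin k G (Set.Icc 0 1) 0 = iteratedDeriv k G 0 := by
    intro k hk
    exact iteratedDerivWithin_eq_iteratedDeriv (uniqueDiffOn_Icc zero_lt_one)
      ((hGc.of_le (by exact_mod_cast hk)).contDiffAt) (by simp)
  refine ⟨|C| + 1, by positivity, 1, one_pos, fun h h0 h1 => ?_⟩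
  have hb := hC h ⟨h0.le, h1.le⟩
  simp only [taylor_within_apply, Finset.sum_range_succ, Finset.sum_range_zero] at hb
  rw [hw 0 (by norm_num), hw 1 (by norm_num), hw 2 (by norm_num), hG2, iteratedDeriv_one, hG1,
    iteratedDeriv_zero, hG0] at hb
  simp at hb
  have hk : (2 * h)⁻¹ • (f (a + h • v) - f (a - h • v)) - fderiv ℝ f a v
      = (2 * h)⁻¹ • (G h - h • (2 : ℝ) • fderiv ℝ f a v) := by
    have h7 : (2 * h)⁻¹ * (h * 2) = 1 := by field_simp
    rw [smul_sub _ (G h), smul_smul h, smul_smul _ (h * 2), h7, one_smul]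
  rw [hk, norm_smul, Real.norm_of_nonneg (by positivity)]
  calc _ ≤ (2 * h)⁻¹ * (C * h ^ 3) := by
        gcongr
    _ = C / 2 * h ^ 2 := by field_simp
    _ ≤ _ := by
        gcongr
        linarith [le_abs_self C, abs_nonneg C]
end

section
/- Let m ≥ 1, let f : ℝ^m → ℝ^m be four times continuously differentiable, and let u : ℝ → ℝ^m solve u' = f(u) on a neighborhood of a point t. For h > 0 set v¹ = f(u(t)) and v²(h) = ( f(u(t)+h·v¹) − f(u(t)−h·v¹) )/(2h). Then there exist constants C > 0 and h₀ > 0 such that for all 0 < h < h₀, ‖ ( f(u(t)+h·v¹+(h²/2)·v²(h)) − 2·f(u(t)) + f(u(t)−h·v¹+(h²/2)·v²(h)) ) / h² − u'''(t) ‖ ≤ C·h. -/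
open Filter Topology Asymptotics

lemma isBigO_pow_succ_of_fderiv {E F : Type*} [NormedAddCommGroup E] [NormedSpace ℝ E]
    [NormedAddCommGroup F] [NormedSpace ℝ F] (R : E → F) (R' : E → E →L[ℝ] F) (n : ℕ)
    (h0 : R 0 = 0) (hd : ∀ w, HasFDerivAt R (R' w) w)
    (hO : R' =O[𝓝 0] fun w => ‖w‖ ^ n) : R =O[𝓝 0] fun w => ‖w‖ ^ (n + 1) := by
  obtain ⟨C, hC⟩ := hO.bound
  obtain ⟨ε, hε, hb⟩ := Metric.eventually_nhds_iff_ball.1 hC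
  refine IsBigO.of_bound (max C 0) ?_
  filter_upwards [Metric.ball_mem_nhds (0 : E) hε] with w hw
  rw [mem_ball_zero_iff] at hw
  have key := (convex_closedBall (0 : E) ‖w‖).norm_image_sub_le_of_norm_hasFDerivWithin_le
    (f := R) (f' := R') (C := max C 0 * ‖w‖ ^ n) (x := 0) (y := w)
    (fun x _ => (hd x).hasFDerivWithinAt) ?_ (by simp) (by simp)
  · simpa [h0, pow_succ, mul_assoc] using key
  · intro x hx
    rw [mem_closedBall_zero_iff] at hx
    have h1 := hb x (by rw [mem_ball_zero_iff]; linarith)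
    rw [norm_pow, norm_norm] at h1
    refine h1.trans ?_
    gcongr
    exact le_max_left _ _

lemma taylor_two {E F : Type*} [NormedAddCommGroup E] [NormedSpace ℝ E]
    [NormedAddCommGroup F] [NormedSpace ℝ F] (f : E → F) (hf : ContDiff ℝ 4 f) (y : E) :
    (fun w => f (y + w) - f y - fderiv ℝ f y w
      - (1 / 2 : ℝ) • fderiv ℝ (fderiv ℝ f) y w w) =O[𝓝 0] fun w => ‖w‖ ^ 3 := by
  have c1 : ContDiff ℝ 3 (fderiv ℝ f) := hf.fderiv_right (by norm_num)
  have c2 : ContDiff ℝ 2 (fderiv ℝ (fderiv ℝ f)) := c1.fderiv_right (by norm_num)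
  have d0 : Differentiable ℝ f := hf.differentiable (by norm_num)
  have d1 : Differentiable ℝ (fderiv ℝ f) := c1.differentiable (by norm_num)
  have d2 : Differentiable ℝ (fderiv ℝ (fderiv ℝ f)) := c2.differentiable (by norm_num)
  have hadd : ∀ w : E, HasFDerivAt (fun w => y + w) (ContinuousLinearMap.id ℝ E) w :=
    fun w => (hasFDerivAt_id w).const_add y
  have sym : ∀ a b, fderiv ℝ (fderiv ℝ f) y a b = fderiv ℝ (fderiv ℝ f) y b a := by
    intro a b
    exact second_derivative_symmetric (fun x => (d0 x).hasFDerivAt) (d1 y).hasFDerivAt a b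
  have hsub : (fun w => fderiv ℝ (fderiv ℝ f) (y + w) - fderiv ℝ (fderiv ℝ f) y)
      =O[𝓝 0] fun w => ‖w‖ ^ 1 := by
    have := DifferentiableAt.isBigO_sub (𝕜 := ℝ) (E := E) (F := E →L[ℝ] E →L[ℝ] F)
      (f := fderiv ℝ (fderiv ℝ f)) (x₀ := y) (d2 y)
    have ht : Tendsto (fun w : E => y + w) (𝓝 0) (𝓝 y) := by
      have : Continuous (fun w : E => y + w) := by fun_prop
      simpa using this.tendsto 0
    have := this.comp_tendsto ht
    simpa [Function.comp_def] using this.norm_right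
  have s1 := isBigO_pow_succ_of_fderiv
    (fun w => fderiv ℝ f (y + w) - fderiv ℝ f y - fderiv ℝ (fderiv ℝ f) y w) _ 1 (by simp)
    (fun w => by
      have := (((d1 (y + w)).hasFDerivAt.comp w (hadd w)).sub_const (fderiv ℝ f y)).sub
        (fderiv ℝ (fderiv ℝ f) y).hasFDerivAt
      simpa only [ContinuousLinearMap.comp_id, Function.comp_def, Pi.sub_def] using this) hsub
  refine isBigO_pow_succ_of_fderiv _ _ 2 (by simp) (fun w => ?_) s1
  have hB : HasFDerivAt (fun w => (1 / 2 : ℝ) • fderiv ℝ (fderiv ℝ f) y w w)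
      (fderiv ℝ (fderiv ℝ f) y w) w := by
    have := ((fderiv ℝ (fderiv ℝ f) y).hasFDerivAt (x := w)).clm_apply (hasFDerivAt_id w)
    have := this.const_smul (1 / 2 : ℝ)
    refine this.congr_fderiv ?_
    ext z
    simp [sym z w]
    rw [← add_smul]; norm_num
  have := ((((d0 (y + w)).hasFDerivAt.comp w (hadd w)).sub_const (f y)).sub
        (fderiv ℝ f y).hasFDerivAt).sub hB
  simpa only [ContinuousLinearMap.comp_id, Function.comp_def, Pi.sub_def] using this

lemma third_deriv {E : Type*} [NormedAddCommGroup E] [NormedSpace ℝ E]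
    (f : E → E) (hf : ContDiff ℝ 4 f) (u : ℝ → E) (t : ℝ)
    (hu : ∀ᶠ x in 𝓝 t, HasDerivAt u (f (u x)) x) :
    iteratedDeriv 3 u t = fderiv ℝ (fderiv ℝ f) (u t) (f (u t)) (f (u t))
      + fderiv ℝ f (u t) (fderiv ℝ f (u t) (f (u t))) := by
  have c1 : ContDiff ℝ 3 (fderiv ℝ f) := hf.fderiv_right (by norm_num)
  have d0 : Differentiable ℝ f := hf.differentiable (by norm_num)
  have d1 : Differentiable ℝ (fderiv ℝ f) := c1.differentiable (by norm_num)
  have e1 : deriv u =ᶠ[𝓝 t] fun x => f (u x) := hu.mono fun x hx => hx.deriv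
  have h2 : ∀ x, HasDerivAt u (f (u x)) x →
      HasDerivAt (fun x => f (u x)) (fderiv ℝ f (u x) (f (u x))) x :=
    fun x hx => (d0 (u x)).hasFDerivAt.comp_hasDerivAt x hx
  have e2 : deriv (deriv u) =ᶠ[𝓝 t] fun x => fderiv ℝ f (u x) (f (u x)) :=
    e1.deriv.trans (hu.mono fun x hx => (h2 x hx).deriv)
  have hx := hu.self_of_nhds
  have h3 : HasDerivAt (fun x => fderiv ℝ f (u x)) (fderiv ℝ (fderiv ℝ f) (u t) (f (u t))) t :=
    (d1 (u t)).hasFDerivAt.comp_hasDerivAt t hx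
  rw [iteratedDeriv_succ, iteratedDeriv_succ, iteratedDeriv_one, e2.deriv_eq]
  exact (h3.clm_apply (h2 t hx)).deriv

lemma main_bigO {E : Type*} [NormedAddCommGroup E] [NormedSpace ℝ E]
    (f : E → E) (hf : ContDiff ℝ 4 f) (y v : E) (V : ℝ → E)
    (hV : V = fun h => (2 * h)⁻¹ • (f (y + h • v) - f (y - h • v))) :
    (fun h : ℝ => (h ^ 2)⁻¹ • (f (y + h • v + (h ^ 2 / 2) • V h) - (2 : ℝ) • f y
      + f (y - h • v + (h ^ 2 / 2) • V h))
      - (fderiv ℝ (fderiv ℝ f) y v v + fderiv ℝ f y (fderiv ℝ f y v)))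
      =O[𝓝[>] 0] fun h => h := by
  have hT := taylor_two f hf y
  set D := fderiv ℝ f y
  set B := fderiv ℝ (fderiv ℝ f) y
  set R : E → E := fun w => f (y + w) - f y - D w - (1 / 2 : ℝ) • B w w with hR
  have hfR : ∀ w, f (y + w) = f y + D w + (1 / 2 : ℝ) • B w w + R w := by
    intro w; simp only [hR]; abel
  have hfR' : ∀ w, f (y - w) = f y - D w + (1 / 2 : ℝ) • B w w + R (-w) := by
    intro w; rw [sub_eq_add_neg, hfR]; simp [sub_eq_add_neg]
  have hpos : ∀ᶠ h : ℝ in 𝓝[>] 0, 0 < h := eventually_mem_nhdsWithin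
  have hid : Tendsto (fun h : ℝ => h) (𝓝[>] 0) (𝓝 0) := tendsto_nhdsWithin_of_tendsto_nhds tendsto_id
  have hlt : ∀ n k : ℕ, n ≤ k → (fun h : ℝ => h ^ k) =O[𝓝[>] 0] fun h : ℝ => h ^ n := by
    intro n k hnk
    refine IsBigO.of_bound 1 ?_
    filter_upwards [hpos, hid.eventually (eventually_le_nhds (zero_lt_one' ℝ))] with h h0 h1
    rw [Real.norm_of_nonneg (by positivity), Real.norm_of_nonneg (by positivity), one_mul]
    exact pow_le_pow_of_le_one h0.le h1 hnk
  -- composition of the remainder with a curve of size `O(h)`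
  have hcomp : ∀ w : ℝ → E, w =O[𝓝[>] 0] (fun h : ℝ => h) →
      (fun h => R (w h)) =O[𝓝[>] 0] fun h : ℝ => h ^ 3 := by
    intro w hw
    exact (hT.comp_tendsto (hw.trans_tendsto hid)).trans (hw.norm_left.pow 3)
  have hhv : (fun h : ℝ => h • v) =O[𝓝[>] 0] (fun h : ℝ => h) := by
    simpa using (isBigO_refl (fun h : ℝ => h) (𝓝[>] 0)).smul
      (isBigO_const_const v (one_ne_zero (α := ℝ)) (𝓝[>] 0))
  have hinv : (fun h : ℝ => (2 * h)⁻¹) =O[𝓝[>] 0] (fun h : ℝ => h⁻¹) := by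
    simp only [mul_inv]; exact isBigO_const_mul_self _ _ _
  have hVD : (fun h => V h - D v) =O[𝓝[>] 0] fun h : ℝ => h ^ 2 := by
    have h1 := hinv.smul ((hcomp _ hhv).sub (hcomp _ hhv.neg_left))
    refine h1.congr' ?_ ?_
    · filter_upwards [hpos] with h hh
      rw [hV]
      simp only [hfR, hfR']
      have : D v = (2 * h)⁻¹ • ((2 * h) • D v) := by
        rw [smul_smul, inv_mul_cancel₀ (by positivity), one_smul]
      rw [this, ← smul_sub]
      congr 1
      simp only [map_smul]
      module
    · filter_upwards [hpos] with h hh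
      simp only [smul_eq_mul]; field_simp
  have hVD1 : (fun h => V h - D v) =O[𝓝[>] 0] fun h : ℝ => h := by
    simpa using hVD.trans (hlt 1 2 (by norm_num))
  have hV1 : V =O[𝓝[>] 0] fun _ : ℝ => (1 : ℝ) := by
    have := (hVD.trans (by simpa using hlt 0 2 (by norm_num))).add
      (isBigO_const_const (D v) (one_ne_zero (α := ℝ)) (𝓝[>] 0))
    simpa using this
  have hq : (fun h : ℝ => (h ^ 2 / 2) • V h) =O[𝓝[>] 0] fun h : ℝ => h := by
    have : (fun h : ℝ => h ^ 2 / 2) =O[𝓝[>] 0] fun h : ℝ => h := by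
      have h1 := (hlt 1 2 (by norm_num)).const_mul_left (1 / 2)
      simp only [pow_one] at h1
      exact h1.congr_left fun h => by ring
    simpa using this.smul hV1
  have hRp := hcomp _ (hhv.add hq)
  have hRm := hcomp _ (hhv.neg_left.add hq)
  have hinv2 : (fun h : ℝ => (h ^ 2)⁻¹ • (R (h • v + (h ^ 2 / 2) • V h)
      + R (-(h • v) + (h ^ 2 / 2) • V h))) =O[𝓝[>] 0] fun h : ℝ => h := by
    refine ((isBigO_refl (fun h : ℝ => (h ^ 2)⁻¹) _).smul (hRp.add hRm)).congr' .rfl ?_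
    filter_upwards [hpos] with h hh
    simp only [smul_eq_mul]; field_simp
  have hDt : (fun h => D (V h - D v)) =O[𝓝[>] 0] fun h : ℝ => h :=
    (D.isBigO_comp _ _).trans hVD1
  have hBt : (fun h : ℝ => (h ^ 2 / 4) • B (V h) (V h)) =O[𝓝[>] 0] fun h : ℝ => h := by
    have h1 : (fun h : ℝ => h ^ 2 / 4) =O[𝓝[>] 0] fun h : ℝ => h := by
      have h1 := (hlt 1 2 (by norm_num)).const_mul_left (1 / 4)
      simp only [pow_one] at h1
      exact h1.congr_left fun h => by ring
    have h2 : (fun h : ℝ => B (V h) (V h)) =O[𝓝[>] 0] fun _ : ℝ => (1 : ℝ) := by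
      have h3 : (fun h : ℝ => B (V h) (V h)) =O[𝓝[>] 0] fun h => ‖V h‖ * ‖V h‖ :=
        IsBigO.of_bound ‖B‖ (Eventually.of_forall fun h => by
          simpa [mul_assoc] using B.le_opNorm₂ (V h) (V h))
      simpa using h3.trans (hV1.norm_left.mul hV1.norm_left)
    simpa using h1.smul h2
  refine ((hinv2.add hDt).add hBt).congr' ?_ .rfl
  filter_upwards [hpos] with h hh
  have a1 : y - h • v + (h ^ 2 / 2) • V h = y + (-(h • v) + (h ^ 2 / 2) • V h) := by abel
  rw [a1, add_assoc y, hfR, hfR]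
  generalize R (h • v + (h ^ 2 / 2) • V h) = r1
  generalize R (-(h • v) + (h ^ 2 / 2) • V h) = r2
  simp only [map_add, map_neg, map_smul, map_sub, ContinuousLinearMap.add_apply,
    ContinuousLinearMap.neg_apply, ContinuousLinearMap.smul_apply]
  generalize D (V h) = x1
  match_scalars <;> field_simp <;> ring



/-- The centered second finite difference of `f` along the degree-2 approximate Taylor
polynomial of `u` approximates `u''' t` to first order, for `u' = f u` with `f ∈ C⁴`. -/
theorem third_derivative_centered_difference (m : ℕ) (hm : 1 ≤ m)
    (f : (Fin m → ℝ) → Fin m → ℝ) (hf : ContDiff ℝ 4 f)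
    (u : ℝ → Fin m → ℝ) (t : ℝ)
    (hu : ∀ᶠ x in nhds t, HasDerivAt u (f (u x)) x) :
    ∃ C > 0, ∃ h₀ > 0, ∀ h : ℝ, 0 < h → h < h₀ →
      ‖(h ^ 2)⁻¹ •
          (f (u t + h • f (u t) +
              (h ^ 2 / 2) • ((2 * h)⁻¹ • (f (u t + h • f (u t)) - f (u t - h • f (u t))))) -
            (2 : ℝ) • f (u t) +
            f (u t - h • f (u t) +
              (h ^ 2 / 2) • ((2 * h)⁻¹ • (f (u t + h • f (u t)) - f (u t - h • f (u t)))))) -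
        iteratedDeriv 3 u t‖ ≤ C * h := by

  have hb := (main_bigO f hf (u t) (f (u t)) _ rfl)
  rw [← third_deriv f hf u t hu] at hb
  obtain ⟨C, hC, hb⟩ := hb.exists_pos
  obtain ⟨h₀, hh₀, hs⟩ := mem_nhdsGT_iff_exists_Ioo_subset.1 hb.bound
  refine ⟨C, hC, h₀, hh₀, fun h h1 h2 => ?_⟩
  have := hs ⟨h1, h2⟩
  simpa only [Set.mem_setOf_eq, Real.norm_of_nonneg h1.le] using this
end
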